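/- Let p be a fixed-size binary tree source. Then there exists a prefix-free code D on the set of binary trees t with P[t] > 0 such that |D(t)| ≤ log₂(1/P[t]) + 2·⌊log₂(|t|+1)⌋ + 3 for every binary tree t with P[t] > 0. -/

import Mathlib

inductive BinTree : Type where
  | leaf : BinTree
  | node : BinTree → BinTree → BinTree
deriving DecidableEq

namespace BinTree

def size : BinTree → ℕ
  | leaf => 0
  | node l r => 1 + size l + size r

def height : BinTree → ℕ
  | leaf => 0
  | node l r => 1 + max (height l) (height r)

def subtreeAt : BinTree → List Bool → BinTree
  | t, [] => t
  | leaf, _ :: _ => leaf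
  | node l r, b :: v => subtreeAt (if b then r else l) v

def countGE (b : ℕ) : BinTree → ℕ
  | leaf => 0
  | node l r => (if b ≤ size (node l r) then 1 else 0) + countGE b l + countGE b r

end BinTree

noncomputable def fsProb (p : ℕ → ℕ → ℝ) : BinTree → ℝ
  | .leaf => 1
  | .node l r => p l.size r.size * fsProb p l * fsProb p r

noncomputable def fhProb (p : ℕ → ℕ → ℝ) : BinTree → ℝ
  | .leaf => 1
  | .node l r => p l.height r.height * fhProb p l * fhProb p r

def IsFixedSizeSource (p : ℕ → ℕ → ℝ) : Prop :=
  (∀ ℓ r, 0 ≤ p ℓ r ∧ p ℓ r ≤ 1) ∧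
  ∀ n : ℕ, ∑ ℓ ∈ Finset.range (n + 1), p ℓ (n - ℓ) = 1

def IsFixedHeightSource (p : ℕ → ℕ → ℝ) : Prop :=
  (∀ i j, 0 ≤ p i j ∧ p i j ≤ 1) ∧
  ∀ h : ℕ,
    ∑ ij ∈ (Finset.range (h + 1) ×ˢ Finset.range (h + 1)).filter
        (fun ij => max ij.1 ij.2 = h), p ij.1 ij.2 = 1

namespace S8

/-- Finset of all trees of height at most `d`. -/
def A : ℕ → Finset BinTree
  | 0 => {BinTree.leaf}
  | d + 1 => insert BinTree.leaf ((A d ×ˢ A d).image (fun x => BinTree.node x.1 x.2))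

theorem mem_A (t : BinTree) : ∀ d, t.height ≤ d → t ∈ A d := by
  induction t with
  | leaf => intro d _; cases d <;> simp [A]
  | node l r ihl ihr =>
    intro d hd
    simp only [BinTree.height] at hd
    cases d with
    | zero => omega
    | succ d =>
      have h1 := ihl d (by omega)
      have h2 := ihr d (by omega)
      simp [A, h1, h2]

theorem countable_tree : Countable BinTree := by
  rw [← Set.countable_univ_iff]
  have : (Set.univ : Set BinTree) = ⋃ d, (A d : Set BinTree) := by
    ext t
    simp only [Set.mem_univ, Set.mem_iUnion, true_iff]
    exact ⟨t.height, mem_A t _ le_rfl⟩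
  rw [this]
  exact Set.countable_iUnion fun d => (A d).countable_toSet

theorem prob_nonneg (p : ℕ → ℕ → ℝ) (hp : IsFixedSizeSource p) (t : BinTree) :
    0 ≤ fsProb p t := by
  induction t with
  | leaf => simp [fsProb]
  | node l r ihl ihr =>
    exact mul_nonneg (mul_nonneg (hp.1 _ _).1 ihl) ihr

theorem sum_A (p : ℕ → ℕ → ℝ) (hp : IsFixedSizeSource p) (d : ℕ) :
    ∀ n, ∑ t ∈ (A d).filter (fun t => t.size = n), fsProb p t ≤ 1 := by
  induction d with
  | zero =>
    intro n
    simp only [A, Finset.filter_singleton]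
    split_ifs <;> simp [fsProb]
  | succ d ih =>
    intro n
    cases n with
    | zero =>
      have : (A (d+1)).filter (fun t => t.size = 0) ⊆ {BinTree.leaf} := by
        intro t ht
        rw [Finset.mem_filter] at ht
        cases t with
        | leaf => simp
        | node l r => simp [BinTree.size] at ht
      refine (Finset.sum_le_sum_of_subset_of_nonneg this
        (fun t _ _ => prob_nonneg p hp t)).trans ?_
      simp [fsProb]
    | succ n =>
      have hsub : (A (d+1)).filter (fun t => t.size = n + 1) ⊆
          (Finset.range (n+1)).biUnion (fun k =>
            (((A d).filter (fun t => t.size = k)) ×ˢ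
              ((A d).filter (fun t => t.size = n - k))).image
                (fun x => BinTree.node x.1 x.2)) := by
        intro t ht
        rw [Finset.mem_filter] at ht
        obtain ⟨h1, h2⟩ := ht
        cases t with
        | leaf => simp [BinTree.size] at h2
        | node l r =>
          simp only [BinTree.size] at h2
          simp [A] at h1
          simp only [Finset.mem_biUnion, Finset.mem_range, Finset.mem_image, Finset.mem_product,
            Finset.mem_filter, Prod.exists]
          exact ⟨l.size, by omega, l, r, ⟨⟨h1.1, rfl⟩, h1.2, by omega⟩, rfl⟩
      refine (Finset.sum_le_sum_of_subset_of_nonneg hsub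
        (fun t _ _ => prob_nonneg p hp t)).trans ?_
      rw [← hp.2 n]
      rw [Finset.sum_biUnion]
      · refine Finset.sum_le_sum fun k _ => ?_
        rw [Finset.sum_image]
        · have : ∀ x ∈ ((A d).filter (fun t => t.size = k)) ×ˢ
              ((A d).filter (fun t => t.size = n - k)),
              fsProb p (BinTree.node x.1 x.2)
                = p k (n-k) * (fsProb p x.1 * fsProb p x.2) := by
            intro x hx
            simp only [Finset.mem_product, Finset.mem_filter] at hx
            simp only [fsProb, hx.1.2, hx.2.2, mul_assoc]
          rw [Finset.sum_congr rfl this, ← Finset.mul_sum, Finset.sum_product,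
            ← Finset.sum_mul_sum]
          exact mul_le_of_le_one_right (hp.1 _ _).1
            (mul_le_one₀ (ih _) (Finset.sum_nonneg fun t _ => prob_nonneg p hp t) (ih _))
        · rintro ⟨a, b⟩ _ ⟨c, e⟩ _ h
          simpa using h
      · intro i _ j _ hij
        rw [Function.onFun, Finset.disjoint_left]
        intro t h1 h2
        simp only [Finset.mem_image, Finset.mem_product,
            Finset.mem_filter, Prod.exists] at h1 h2
        obtain ⟨a, b, h1, rfl⟩ := h1
        obtain ⟨a', b', h2, h3⟩ := h2
        injection h3 with h3 h4
        subst h3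
        exact hij (h1.1.2.symm.trans h2.1.2)

theorem sum_size (p : ℕ → ℕ → ℝ) (hp : IsFixedSizeSource p) (S : Finset BinTree) (n : ℕ) :
    ∑ t ∈ S.filter (fun t => t.size = n), fsProb p t ≤ 1 := by
  refine le_trans (Finset.sum_le_sum_of_subset_of_nonneg ?_
    (fun t _ _ => prob_nonneg p hp t)) (sum_A p hp (S.sup BinTree.height) n)
  intro t ht
  rw [Finset.mem_filter] at ht ⊢
  exact ⟨mem_A t _ (Finset.le_sup (f := BinTree.height) ht.1), ht.2⟩

noncomputable def g (n : ℕ) : ℝ := (1/2) ^ (2 * Nat.log 2 (n + 1) + 1)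

theorem g_pos (n : ℕ) : 0 < g n := by unfold g; positivity

theorem sum_g_pow (k : ℕ) : ∑ n ∈ Finset.range (2^k - 1), g n = 1 - (1/2)^k := by
  induction k with
  | zero => simp
  | succ k ih =>
    have h1 : 1 ≤ 2^k := Nat.one_le_two_pow
    have h2 : 2^(k+1) - 1 = (2^k - 1) + 2^k := by rw [pow_succ]; omega
    rw [h2, Finset.sum_range_add, ih]
    have : ∀ x ∈ Finset.range (2^k), g (2^k - 1 + x) = (1/2)^(2*k+1) := by
      intro x hx
      rw [Finset.mem_range] at hx
      unfold g
      have : Nat.log 2 (2^k - 1 + x + 1) = k := by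
        apply Nat.log_eq_of_pow_le_of_lt_pow
        · omega
        · rw [pow_succ]; omega
      rw [this]
    rw [Finset.sum_congr rfl this, Finset.sum_const, Finset.card_range, nsmul_eq_mul]
    push_cast
    have h3 : (2:ℝ)^k * (1/2)^k = 1 := by rw [← mul_pow]; norm_num
    rw [pow_succ, pow_succ, two_mul, pow_add]
    linear_combination (1/2) * (1/2:ℝ)^k * h3

theorem sum_g (N : ℕ) : ∑ n ∈ Finset.range N, g n ≤ 1 := by
  have : N ≤ 2^N - 1 := by have := @Nat.lt_two_pow_self N; omega
  refine (Finset.sum_le_sum_of_subset_of_nonneg (Finset.range_mono this)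
    (fun n _ _ => (g_pos n).le)).trans ?_
  rw [sum_g_pow]
  have : (0:ℝ) < (1/2)^N := by positivity
  linarith

noncomputable def w (p : ℕ → ℕ → ℝ) (t : BinTree) : ℝ := g t.size * fsProb p t

theorem w_nonneg (p : ℕ → ℕ → ℝ) (hp : IsFixedSizeSource p) (t : BinTree) : 0 ≤ w p t :=
  mul_nonneg (g_pos _).le (prob_nonneg p hp t)

theorem sum_w (p : ℕ → ℕ → ℝ) (hp : IsFixedSizeSource p) (S : Finset BinTree) :
    ∑ t ∈ S, w p t ≤ 1 := by
  have hmaps : ∀ t ∈ S, t.size ∈ Finset.range (S.sup BinTree.size + 1) := by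
    intro t ht
    rw [Finset.mem_range]
    exact Nat.lt_succ_of_le (Finset.le_sup (f := BinTree.size) ht)
  rw [← Finset.sum_fiberwise_of_maps_to hmaps]
  refine le_trans (Finset.sum_le_sum fun n _ => ?_) (sum_g (S.sup BinTree.size + 1))
  have : ∀ t ∈ S.filter (fun t => t.size = n), w p t = g n * fsProb p t := by
    intro t ht
    rw [Finset.mem_filter] at ht
    rw [w, ht.2]
  rw [Finset.sum_congr rfl this, ← Finset.mul_sum]
  exact mul_le_of_le_one_right (g_pos _).le (sum_size p hp S n)

/-- Value of a bit string read as a binary fraction. -/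
noncomputable def val : List Bool → ℝ
  | [] => 0
  | b :: l => ((if b then 1 else 0) + val l) / 2

theorem val_bounds (l : List Bool) : 0 ≤ val l ∧ val l < 1 := by
  induction l with
  | nil => simp [val]
  | cons b l ih =>
    cases b <;> simp only [val] <;> norm_num <;> constructor <;> linarith [ih.1, ih.2]

theorem val_append (l s : List Bool) :
    val (l ++ s) = val l + (1/2)^l.length * val s := by
  induction l with
  | nil => simp [val]
  | cons b l ih =>
    simp only [List.cons_append, val, ih, List.length_cons, pow_succ]
    ring

theorem exists_val (L : ℕ) : ∀ x : ℝ, 0 ≤ x → x < 1 →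
    ∃ l : List Bool, l.length = L ∧ val l ≤ x ∧ x < val l + (1/2)^L := by
  induction L with
  | zero => intro x h0 h1; exact ⟨[], rfl, by simpa [val] using h0, by simpa [val] using h1⟩
  | succ L ih =>
    intro x h0 h1
    by_cases h : x < 1/2
    · obtain ⟨l, hl, h2, h3⟩ := ih (2*x) (by linarith) (by linarith)
      refine ⟨false :: l, by simp [hl], ?_, ?_⟩
      · simp [val]; linarith
      · simp only [val, pow_succ]; norm_num at h3 ⊢; linarith
    · obtain ⟨l, hl, h2, h3⟩ := ih (2*x-1) (by linarith) (by linarith)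
      refine ⟨true :: l, by simp [hl], ?_, ?_⟩
      · simp [val]; linarith
      · simp only [val, pow_succ]; norm_num at h3 ⊢; linarith

/-- Shannon-Fano-Elias code words exist. -/
theorem exists_word (F u : ℝ) (hF : 0 ≤ F) (hu : 0 < u) (h1 : F + u ≤ 1) :
    ∃ l : List Bool, (l.length : ℝ) ≤ Real.logb 2 (1 / u) + 2 ∧
      F ≤ val l ∧ val l + (1/2)^l.length ≤ F + u := by
  have hlog : 0 ≤ Real.logb 2 (1/u) :=
    Real.logb_nonneg (by norm_num) (by rw [le_div_iff₀ hu]; linarith)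
  obtain ⟨l, hl, h2, h3⟩ := exists_val (⌈Real.logb 2 (1/u)⌉₊ + 1) (F + u/2)
    (by linarith) (by linarith)
  have hle : (1/2:ℝ)^⌈Real.logb 2 (1/u)⌉₊ ≤ u := by
    have h4 : 1/u ≤ (2:ℝ)^⌈Real.logb 2 (1/u)⌉₊ := by
      rw [← Real.rpow_natCast, ← Real.logb_le_iff_le_rpow (by norm_num) (by positivity)]
      exact Nat.le_ceil _
    rw [one_div_pow]
    exact (one_div_le hu (by positivity)).1 h4
  refine ⟨l, ?_, ?_, ?_⟩
  · rw [hl]; push_cast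
    linarith [Nat.ceil_lt_add_one hlog]
  · rw [pow_succ] at h3; linarith
  · rw [hl, pow_succ]; linarith

theorem main (p : ℕ → ℕ → ℝ) (hp : IsFixedSizeSource p) :
    ∃ D : BinTree → List Bool,
      (∀ t₁ t₂ : BinTree, 0 < fsProb p t₁ → 0 < fsProb p t₂ → t₁ ≠ t₂ →
          ¬ (D t₁ <+: D t₂)) ∧
      ∀ t : BinTree, 0 < fsProb p t →
        ((D t).length : ℝ) ≤
          Real.logb 2 (1 / fsProb p t) + 2 * (Nat.log 2 (t.size + 1) : ℝ) + 3 := by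
  classical
  haveI := countable_tree
  obtain ⟨f, hf⟩ := exists_injective_nat BinTree
  have hfin : ∀ n : ℕ, (f ⁻¹' Set.Iio n).Finite := fun n =>
    (Set.finite_Iio n).preimage hf.injOn
  let B : ℕ → Finset BinTree := fun n => (hfin n).toFinset
  have hB : ∀ n t, t ∈ B n ↔ f t < n := fun n t => by simp [B]
  let F : BinTree → ℝ := fun t => ∑ s ∈ B (f t), w p s
  have hF0 : ∀ t, 0 ≤ F t := fun t => Finset.sum_nonneg fun s _ => w_nonneg p hp s
  have hins : ∀ t, F t + w p t = ∑ s ∈ insert t (B (f t)), w p s := by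
    intro t
    rw [Finset.sum_insert (by simp [hB]), add_comm]
  have hF1 : ∀ t, F t + w p t ≤ 1 := fun t => by rw [hins]; exact sum_w p hp _
  have hmono : ∀ s t, f s < f t → F s + w p s ≤ F t := by
    intro s t hst
    rw [hins]
    refine Finset.sum_le_sum_of_subset_of_nonneg ?_ (fun a _ _ => w_nonneg p hp a)
    intro a ha
    rw [Finset.mem_insert, hB] at ha
    rw [hB]
    rcases ha with rfl | ha <;> omega
  have hex : ∀ t, ∃ l : List Bool, 0 < fsProb p t →
      ((l.length : ℝ) ≤ Real.logb 2 (1 / w p t) + 2 ∧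
      F t ≤ val l ∧ val l + (1/2)^l.length ≤ F t + w p t) := by
    intro t
    by_cases h : 0 < fsProb p t
    · obtain ⟨l, hl⟩ := exists_word (F t) (w p t) (hF0 t) (mul_pos (g_pos _) h) (hF1 t)
      exact ⟨l, fun _ => hl⟩
    · exact ⟨[], fun h' => absurd h' h⟩
  choose D hD using hex
  refine ⟨D, ?_, ?_⟩
  · intro s t hs ht hne hpre
    obtain ⟨x, hx⟩ := hpre
    obtain ⟨-, hs1, hs2⟩ := hD s hs
    obtain ⟨-, ht1, ht2⟩ := hD t ht
    have hv := val_append (D s) x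
    rw [hx] at hv
    have hxb := val_bounds x
    have hpos : (0:ℝ) < (1/2)^(D s).length := by positivity
    have hpos2 : (0:ℝ) < (1/2)^(D t).length := by positivity
    have ha : val (D s) ≤ val (D t) := by
      rw [hv]; linarith [mul_nonneg hpos.le hxb.1]
    have hb : val (D t) < val (D s) + (1/2)^(D s).length := by
      rw [hv]; linarith [mul_lt_of_lt_one_right hpos hxb.2]
    rcases lt_or_gt_of_ne (hf.ne hne) with h | h
    · have := hmono s t h; linarith
    · have := hmono t s h; linarith
  · intro t ht
    refine (hD t ht).1.trans (le_of_eq ?_)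
    have : Real.logb 2 (1 / w p t) =
        Real.logb 2 (1 / fsProb p t) + (2 * (Nat.log 2 (t.size + 1) : ℝ) + 1) := by
      have e : 1 / w p t = 1 / fsProb p t * (2:ℝ)^(2 * Nat.log 2 (t.size + 1) + 1) := by
        rw [w, g, one_div_pow]; field_simp
      rw [e, Real.logb_mul (by positivity) (by positivity), Real.logb_pow,
        Real.logb_self_eq_one (by norm_num)]
      push_cast; ring
    rw [this]; ring

end S8

/-- depth-first arithmetic coding: for every fixed-size source
there is a prefix-free code `D` on the trees of positive probability with
`|D(t)| ≤ lg(1/P[t]) + 2⌊lg(|t|+1)⌋ + 3`. -/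
theorem statement8 (p : ℕ → ℕ → ℝ) (hp : IsFixedSizeSource p) :
    ∃ D : BinTree → List Bool,
      (∀ t₁ t₂ : BinTree, 0 < fsProb p t₁ → 0 < fsProb p t₂ → t₁ ≠ t₂ →
          ¬ (D t₁ <+: D t₂)) ∧
      ∀ t : BinTree, 0 < fsProb p t →
        ((D t).length : ℝ) ≤
          Real.logb 2 (1 / fsProb p t) + 2 * (Nat.log 2 (t.size + 1) : ℝ) + 3 := by
  exact S8.main p hp
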